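/- arXiv:2206.07954 — 2 statements merged into one kernel-verified Lean document; each statement's English description precedes it below -/
import Mathlib

section
/- Let M be a finitely generated ℤ-module equipped with a Hilbertian seminorm ‖·‖ on M ⊗ ℝ, and let 0 = F_0 ⊆ F_1 ⊆ … ⊆ F_k = M be a filtration of M by submodules. For each 0 ≤ i < k, endow (F_{i+1}/F_i) ⊗ ℝ with the subquotient seminorm obtained by restricting ‖·‖ to F_{i+1} ⊗ ℝ and then taking the quotient seminorm on (F_{i+1} ⊗ ℝ)/(F_i ⊗ ℝ) ≅ (F_{i+1}/F_i) ⊗ ℝ. Then, as an equality in ℝ ∪ {+∞}, χ̂(M, ‖·‖) = Σ_{i=0}^{k−1} χ̂(F_{i+1}/F_i, subquotient seminorm). -/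
open scoped TensorProduct

/-- A function on `M ⊗ ℝ` (realized as `ℝ ⊗[ℤ] M`) is a *Hilbertian seminorm* if it is of the
form `x ↦ √(B x x)` for some positive semidefinite symmetric real bilinear form `B`. -/
def IsHilbertianSeminorm (M : Type*) [AddCommGroup M]
    (nrm : (ℝ ⊗[ℤ] M) → ℝ) : Prop :=
  ∃ B : (ℝ ⊗[ℤ] M) →ₗ[ℝ] (ℝ ⊗[ℤ] M) →ₗ[ℝ] ℝ,
    (∀ x y, B x y = B y x) ∧ (∀ x, 0 ≤ B x x) ∧ (∀ x, nrm x = Real.sqrt (B x x))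

/-- The polarization form of a Hilbertian seminorm on `M ⊗ ℝ`. -/
noncomputable def polarForm (M : Type*) [AddCommGroup M]
    (nrm : (ℝ ⊗[ℤ] M) → ℝ) (x y : ℝ ⊗[ℤ] M) : ℝ :=
  (nrm (x + y) ^ 2 - nrm x ^ 2 - nrm y ^ 2) / 2

/-- `v : Fin n → M` is a basis of `M` modulo its torsion submodule. -/
def IsBasisModTorsion (M : Type*) [AddCommGroup M]
    (n : ℕ) (v : Fin n → M) : Prop :=
  (∀ x : M, ∃ c : Fin n → ℤ, x - ∑ i, c i • v i ∈ Submodule.torsion ℤ M) ∧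
  (∀ c : Fin n → ℤ, (∑ i, c i • v i) ∈ Submodule.torsion ℤ M → c = 0)

/-- The arithmetic degree `χ̂(M, ‖·‖) ∈ ℝ ∪ {+∞}` of a finitely generated `ℤ`-module `M`
equipped with a Hilbertian seminorm `‖·‖` on `M ⊗ ℝ`: it equals `0` if `M = 0`, `+∞` if the
seminorm is not definite, and `- log covol(M, ‖·‖) + log #M_tor` otherwise; here the covolume
is computed as the square root of the Gram determinant of a basis of `M` modulo torsion
(the bilinear form being recovered from the seminorm by polarization). -/
noncomputable def chiHat (M : Type*) [AddCommGroup M]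
    (nrm : (ℝ ⊗[ℤ] M) → ℝ) : EReal := by
  classical
  by_cases hM : Subsingleton M
  · exact 0
  by_cases hdef : ∃ x : ℝ ⊗[ℤ] M, x ≠ 0 ∧ nrm x = 0
  · exact ⊤
  by_cases hb : ∃ (n : ℕ) (v : Fin n → M), IsBasisModTorsion M n v
  · exact
      let n := hb.choose
      let v := hb.choose_spec.choose
      (((- (1 / 2 : ℝ)) * Real.log
          ((Matrix.of fun i j : Fin n =>
            polarForm M nrm ((1 : ℝ) ⊗ₜ[ℤ] v i) ((1 : ℝ) ⊗ₜ[ℤ] v j)).det)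
        + Real.log (Nat.card (Submodule.torsion ℤ M)) : ℝ) : EReal)
  · exact 0

section ArithmeticDegree

variable {M : Type*} [AddCommGroup M]

lemma polarForm_eq_of_sqrt {nrm : (ℝ ⊗[ℤ] M) → ℝ}
    {B : LinearMap.BilinForm ℝ (ℝ ⊗[ℤ] M)} (hsymm : ∀ x y, B x y = B y x)
    (hnonneg : ∀ x, 0 ≤ B x x) (hnrm : ∀ x, nrm x = Real.sqrt (B x x)) (x y : ℝ ⊗[ℤ] M) :
    polarForm M nrm x y = B x y := by
  rw [polarForm, hnrm, hnrm, hnrm, Real.sq_sqrt (hnonneg _), Real.sq_sqrt (hnonneg _),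
    Real.sq_sqrt (hnonneg _)]
  simp only [map_add, LinearMap.add_apply]
  rw [hsymm y x]
  ring

lemma chiHat_ne_bot (nrm : (ℝ ⊗[ℤ] M) → ℝ) : chiHat M nrm ≠ ⊥ := by
  unfold chiHat
  split_ifs
  · exact EReal.zero_ne_bot
  · exact top_ne_bot
  · exact EReal.coe_ne_bot _
  · exact EReal.zero_ne_bot

lemma chiHat_of_subsingleton [h : Subsingleton M] (nrm : (ℝ ⊗[ℤ] M) → ℝ) : chiHat M nrm = 0 :=
  dif_pos h

lemma chiHat_eq_top {nrm : (ℝ ⊗[ℤ] M) → ℝ} {x : ℝ ⊗[ℤ] M} (hx : x ≠ 0) (hx0 : nrm x = 0) :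
    chiHat M nrm = ⊤ := by
  have hM : ¬ Subsingleton M := fun _ => hx (Subsingleton.elim _ _)
  unfold chiHat
  rw [dif_neg hM, dif_pos ⟨x, hx, hx0⟩]

namespace IsBasisModTorsion

variable {n : ℕ} {v : Fin n → M}

lemma linearIndependent (hv : IsBasisModTorsion M n v) : LinearIndependent ℤ v := by
  rw [Fintype.linearIndependent_iff]
  intro c hc i
  rw [hv.2 c (hc ▸ zero_mem _), Pi.zero_apply]

/-- The coordinates with respect to a basis modulo torsion. -/
lemma exists_coord (hv : IsBasisModTorsion M n v) :
    ∃ π : M →ₗ[ℤ] (Fin n → ℤ), Function.Surjective π ∧ LinearMap.ker π = Submodule.torsion ℤ M ∧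
      ∀ x, x - ∑ i, π x i • v i ∈ Submodule.torsion ℤ M := by
  choose c hc using hv.1
  have huniq : ∀ x d, x - ∑ i, d i • v i ∈ Submodule.torsion ℤ M → c x = d := by
    intro x d hd
    have h : ∑ i, (c x - d) i • v i ∈ Submodule.torsion ℤ M := by
      convert sub_mem hd (hc x) using 1
      simp only [Pi.sub_apply, sub_smul, Finset.sum_sub_distrib]
      abel
    exact sub_eq_zero.mp (hv.2 _ h)
  let π : M →+ (Fin n → ℤ) := AddMonoidHom.mk' c fun x y => huniq _ _ <| by
    convert add_mem (hc x) (hc y) using 1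
    simp only [Pi.add_apply, add_smul, Finset.sum_add_distrib]
    abel
  refine ⟨π.toIntLinearMap, fun d => ⟨∑ i, d i • v i, huniq _ _ (by simp)⟩, ?_, hc⟩
  ext x
  rw [LinearMap.mem_ker]
  constructor
  · intro hx
    have hcx : c x = 0 := hx
    simpa [hcx] using hc x
  · intro hx
    exact huniq _ _ (by simpa using hx)

lemma one_tmul_eq_zero_of_mem_torsion {x : M} (hx : x ∈ Submodule.torsion ℤ M) :
    (1 : ℝ) ⊗ₜ[ℤ] x = 0 := by
  obtain ⟨a, ha⟩ := hx
  have ha0 : ((a : ℤ) : ℝ) ≠ 0 := by exact_mod_cast nonZeroDivisors.coe_ne_zero a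
  have h : ((a : ℤ) : ℝ) • ((1 : ℝ) ⊗ₜ[ℤ] x) = 0 := by
    rw [Int.cast_smul_eq_zsmul, ← TensorProduct.tmul_smul]
    have : (a : ℤ) • x = 0 := ha
    rw [this, TensorProduct.tmul_zero]
  exact (smul_eq_zero.mp h).resolve_left ha0

lemma one_tmul_eq_sum {x : M} {c : Fin n → ℤ}
    (h : x - ∑ i, c i • v i ∈ Submodule.torsion ℤ M) :
    (1 : ℝ) ⊗ₜ[ℤ] x = ∑ i, (c i : ℝ) • ((1 : ℝ) ⊗ₜ[ℤ] v i) := by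
  have := one_tmul_eq_zero_of_mem_torsion h
  rw [TensorProduct.tmul_sub, sub_eq_zero] at this
  rw [this, TensorProduct.tmul_sum]
  refine Finset.sum_congr rfl fun i _ => ?_
  rw [TensorProduct.tmul_smul, Int.cast_smul_eq_zsmul]

lemma span_one_tmul (hv : IsBasisModTorsion M n v) :
    Submodule.span ℝ (Set.range fun i => (1 : ℝ) ⊗ₜ[ℤ] v i) = ⊤ := by
  rw [eq_top_iff]
  rintro x -
  induction x using TensorProduct.induction_on with
  | zero => exact zero_mem _
  | add x y hx hy => exact add_mem hx hy
  | tmul t x =>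
    obtain ⟨c, hc⟩ := hv.1 x
    have : t ⊗ₜ[ℤ] x = t • ((1 : ℝ) ⊗ₜ[ℤ] x) := by simp [TensorProduct.smul_tmul']
    rw [this, one_tmul_eq_sum hc]
    exact Submodule.smul_mem _ _ (Submodule.sum_mem _ fun i _ =>
      Submodule.smul_mem _ _ (Submodule.subset_span ⟨i, rfl⟩))

/-- A basis of `M` modulo torsion gives a real basis of `M ⊗ ℝ`. -/
noncomputable def realBasis (hv : IsBasisModTorsion M n v) : Module.Basis (Fin n) ℝ (ℝ ⊗[ℤ] M) :=
  Module.Basis.mk (Module.Flat.linearIndependent_one_tmul hv.linearIndependent)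
    hv.span_one_tmul.ge

@[simp]
lemma realBasis_apply (hv : IsBasisModTorsion M n v) (i : Fin n) :
    hv.realBasis i = (1 : ℝ) ⊗ₜ[ℤ] v i := by
  simp [realBasis]

end IsBasisModTorsion

lemma exists_isBasisModTorsion (M : Type*) [AddCommGroup M] [Module.Finite ℤ M] :
    ∃ (n : ℕ) (v : Fin n → M), IsBasisModTorsion M n v := by
  let b := Module.finBasis ℤ (M ⧸ Submodule.torsion ℤ M)
  have hmem : ∀ y : M, y ∈ Submodule.torsion ℤ M ↔ (Submodule.torsion ℤ M).mkQ y = 0 :=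
    fun y => (Submodule.Quotient.mk_eq_zero _).symm
  choose v hv using fun i => Submodule.mkQ_surjective _ (b i)
  refine ⟨_, v, fun x => ⟨fun i => b.repr (Submodule.mkQ _ x) i, ?_⟩, fun c hc => ?_⟩
  · rw [hmem, map_sub, map_sum]
    simp only [map_zsmul, hv]
    rw [sub_eq_zero]
    exact (b.sum_repr _).symm
  · rw [hmem, map_sum] at hc
    simp only [map_zsmul, hv] at hc
    exact funext (Fintype.linearIndependent_iff.mp b.linearIndependent c hc)

/-- For a definite norm, `chiHat` is given by the Gram determinant of some basis modulo torsion. -/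
lemma exists_chiHat_eq [Module.Finite ℤ M] {nrm : (ℝ ⊗[ℤ] M) → ℝ}
    {B : LinearMap.BilinForm ℝ (ℝ ⊗[ℤ] M)} (hsymm : ∀ x y, B x y = B y x)
    (hpos : ∀ x, x ≠ 0 → 0 < B x x) (hnrm : ∀ x, nrm x = Real.sqrt (B x x)) :
    ∃ (n : ℕ) (v : Fin n → M) (hv : IsBasisModTorsion M n v),
      chiHat M nrm = ((-(1 / 2 : ℝ) * Real.log (LinearMap.BilinForm.toMatrix hv.realBasis B).det
        + Real.log (Nat.card (Submodule.torsion ℤ M)) : ℝ) : EReal) := by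
  have hb := exists_isBasisModTorsion M
  by_cases hM : Subsingleton M
  · obtain rfl : nrm = fun _ => 0 := by
      ext x
      rw [hnrm, Subsingleton.elim x 0]
      simp
    refine ⟨0, 0, ⟨fun x => ⟨0, ?_⟩, fun c _ => Subsingleton.elim _ _⟩, ?_⟩
    · rw [Subsingleton.elim (x - _) 0]
      exact zero_mem _
    · rw [chiHat_of_subsingleton, Matrix.det_isEmpty, Nat.card_of_subsingleton 0]
      simp
  have hnonneg : ∀ x, 0 ≤ B x x := fun x => by
    by_cases hx : x = 0
    · simp [hx]
    · exact (hpos x hx).le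
  have hdef : ¬ ∃ x : ℝ ⊗[ℤ] M, x ≠ 0 ∧ nrm x = 0 := by
    rintro ⟨x, hx, hx0⟩
    rw [hnrm] at hx0
    exact (Real.sqrt_pos.mpr (hpos x hx)).ne' hx0
  refine ⟨hb.choose, hb.choose_spec.choose, hb.choose_spec.choose_spec, ?_⟩
  unfold chiHat
  rw [dif_neg hM, dif_neg hdef, dif_pos hb]
  have hgram : LinearMap.BilinForm.toMatrix
      (IsBasisModTorsion.realBasis hb.choose_spec.choose_spec) B = Matrix.of fun i j =>
        polarForm M nrm ((1 : ℝ) ⊗ₜ[ℤ] hb.choose_spec.choose i)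
          ((1 : ℝ) ⊗ₜ[ℤ] hb.choose_spec.choose j) := by
    ext i j
    simp [LinearMap.BilinForm.toMatrix_apply, polarForm_eq_of_sqrt hsymm hnonneg hnrm]
  rw [hgram]

end ArithmeticDegree

section Index

lemma AddSubgroup.index_eq_index_comap_mul_index_map {N M Q : Type*} [AddCommGroup N]
    [AddCommGroup M] [AddCommGroup Q] {f : N →+ M} {g : M →+ Q}
    (hg : Function.Surjective g) (hfg : f.range = g.ker) (L : AddSubgroup M) :
    L.index = (L.comap f).index * (L.map g).index := by
  rw [AddSubgroup.index_comap, hfg, AddSubgroup.index_map, AddMonoidHom.range_eq_top.mpr hg,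
    AddSubgroup.index_top, mul_one, ← AddSubgroup.relIndex_sup_right, sup_comm g.ker L,
    AddSubgroup.relIndex_mul_index le_sup_left]

lemma LinearIndependent.disjoint_span_torsion {ι M : Type*} [Fintype ι] [AddCommGroup M]
    {w : ι → M} (hw : LinearIndependent ℤ w) :
    Disjoint (Submodule.span ℤ (Set.range w)) (Submodule.torsion ℤ M) := by
  rw [Submodule.disjoint_def]
  rintro x hx ⟨a, ha⟩
  obtain ⟨c, rfl⟩ := (Submodule.mem_span_range_iff_exists_fun ℤ).mp hx
  have ha' : ∑ i, ((a : ℤ) * c i) • w i = 0 := by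
    simp only [mul_smul, ← Finset.smul_sum]
    exact ha
  refine Finset.sum_eq_zero fun i _ => ?_
  have := Fintype.linearIndependent_iff.mp hw _ ha' i
  rw [(mul_eq_zero.mp this).resolve_left (nonZeroDivisors.coe_ne_zero a), zero_smul]

lemma finite_torsion (M : Type*) [AddCommGroup M] [Module.Finite ℤ M] :
    Finite (Submodule.torsion ℤ M) :=
  Module.finite_of_fg_torsion _ (Submodule.torsion_isTorsion)

lemma IsBasisModTorsion.index_span_ne_zero {M : Type*} [AddCommGroup M] [Module.Finite ℤ M]
    {n : ℕ} {v : Fin n → M} (hv : IsBasisModTorsion M n v) :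
    (Submodule.span ℤ (Set.range v)).toAddSubgroup.index ≠ 0 := by
  have htop : (Submodule.torsion ℤ M).toAddSubgroup ⊔
      (Submodule.span ℤ (Set.range v)).toAddSubgroup = ⊤ := by
    rw [eq_top_iff]
    intro x _
    obtain ⟨c, hc⟩ := hv.1 x
    rw [← sub_add_cancel x (∑ i, c i • v i)]
    exact add_mem (AddSubgroup.mem_sup_left hc) (AddSubgroup.mem_sup_right
      (Submodule.sum_mem _ fun i _ => Submodule.smul_mem _ _ (Submodule.subset_span ⟨i, rfl⟩)))
  have : Finite (Submodule.torsion ℤ M).toAddSubgroup := finite_torsion M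
  rw [← AddSubgroup.relIndex_top_right, ← htop, AddSubgroup.relIndex_sup_right]
  exact AddSubgroup.index_ne_zero_of_finite

lemma LinearIndependent.index_span_eq {M : Type*} [AddCommGroup M] {n : ℕ}
    {π : M →ₗ[ℤ] (Fin n → ℤ)}
    (hsurj : Function.Surjective π) (hker : LinearMap.ker π = Submodule.torsion ℤ M)
    {w : Fin n → M} (hw : LinearIndependent ℤ w) :
    (Submodule.span ℤ (Set.range w)).toAddSubgroup.index =
      Nat.card (Submodule.torsion ℤ M) * (Matrix.of fun i j => π (w j) i).det.natAbs := by
  have hdisj := hw.disjoint_span_torsion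
  have hli : LinearIndependent ℤ (π ∘ w) := hw.map (hker ▸ hdisj)
  rw [AddSubgroup.index_eq_index_comap_mul_index_map
    (f := (Submodule.torsion ℤ M).toAddSubgroup.subtype) (g := π.toAddMonoidHom)
    hsurj (by rw [AddSubgroup.range_subtype, ← hker]; rfl)]
  congr 1
  · have hcomap : (Submodule.span ℤ (Set.range w)).toAddSubgroup.comap
        (Submodule.torsion ℤ M).toAddSubgroup.subtype = ⊥ := by
      rw [eq_bot_iff]
      intro x hx
      exact Subtype.ext (Submodule.disjoint_def.mp hdisj _ hx x.2)
    rw [hcomap, AddSubgroup.index_bot]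
    rfl
  · have hmap : (Submodule.span ℤ (Set.range w)).toAddSubgroup.map π.toAddMonoidHom =
        (Submodule.span ℤ (Set.range (π ∘ w))).toAddSubgroup := by
      rw [Set.range_comp, Submodule.span_image]
      rfl
    rw [hmap]
    have := Submodule.natAbs_det_basis_change (Pi.basisFun ℤ (Fin n)) _ (Module.Basis.span hli)
    refine Eq.trans this.symm ?_
    congr 1
    rw [Module.Basis.det_apply]
    congr 1
    ext i j
    simp [Module.Basis.toMatrix_apply, Module.Basis.span_apply]

lemma linearIndependent_of_one_tmul {ι M : Type*} [Fintype ι] [AddCommGroup M] {w : ι → M}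
    (hw : LinearIndependent ℝ fun i => (1 : ℝ) ⊗ₜ[ℤ] w i) : LinearIndependent ℤ w := by
  rw [Fintype.linearIndependent_iff] at hw ⊢
  intro c hc i
  have h : ∑ i, (c i : ℝ) • ((1 : ℝ) ⊗ₜ[ℤ] w i) = 0 := by
    simp only [Int.cast_smul_eq_zsmul, ← TensorProduct.tmul_smul, ← TensorProduct.tmul_sum, hc,
      TensorProduct.tmul_zero]
  exact_mod_cast hw _ h i

/-- The Gram determinant of a positive definite form in any basis is nonzero. -/
lemma LinearMap.BilinForm.toMatrix_det_ne_zero_of_pos {ι V : Type*} [Fintype ι]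
    [DecidableEq ι] [AddCommGroup V] [Module ℝ V]
    {B : LinearMap.BilinForm ℝ V} (hpos : ∀ x, x ≠ 0 → 0 < B x x) (b : Module.Basis ι ℝ V) :
    (LinearMap.BilinForm.toMatrix b B).det ≠ 0 := by
  rw [← LinearMap.BilinForm.nondegenerate_iff_det_ne_zero]
  constructor
  · intro x hx
    by_contra h
    exact (hpos x h).ne' (hx x)
  · intro x hx
    by_contra h
    exact (hpos x h).ne' (hx x)

/-- `chiHat` can be computed from any family in `M` which is a real basis of `M ⊗ ℝ`. -/
lemma chiHat_eq_of_basis {ι M : Type*} [Fintype ι] [DecidableEq ι] [AddCommGroup M]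
    [Module.Finite ℤ M] {nrm : (ℝ ⊗[ℤ] M) → ℝ}
    {B : LinearMap.BilinForm ℝ (ℝ ⊗[ℤ] M)} (hsymm : ∀ x y, B x y = B y x)
    (hpos : ∀ x, x ≠ 0 → 0 < B x x) (hnrm : ∀ x, nrm x = Real.sqrt (B x x))
    {w : ι → M} (bw : Module.Basis ι ℝ (ℝ ⊗[ℤ] M)) (hbw : ∀ i, bw i = (1 : ℝ) ⊗ₜ[ℤ] w i) :
    chiHat M nrm = ((-(1 / 2 : ℝ) * Real.log (LinearMap.BilinForm.toMatrix bw B).det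
      + Real.log (Submodule.span ℤ (Set.range w)).toAddSubgroup.index : ℝ) : EReal) := by
  obtain ⟨n, v, hv, h⟩ := exists_chiHat_eq hsymm hpos hnrm
  obtain ⟨π, hsurj, hker, hπ⟩ := hv.exists_coord
  let e : Fin n ≃ ι := hv.realBasis.indexEquiv bw
  let A : Matrix (Fin n) (Fin n) ℤ := Matrix.of fun i j => π (w (e j)) i
  have hw : LinearIndependent ℤ w := by
    refine linearIndependent_of_one_tmul ?_
    simpa only [← hbw] using bw.linearIndependent
  have hindex := (hw.comp e e.injective).index_span_eq hsurj hker
  rw [Set.range_comp, Set.range_eq_univ.mpr e.surjective, Set.image_univ] at hindex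
  have hA : hv.realBasis.toMatrix (bw.reindex e.symm) = A.map (Int.castRingHom ℝ) := by
    ext i j
    rw [Module.Basis.toMatrix_apply, Module.Basis.reindex_apply, Equiv.symm_symm, hbw,
      IsBasisModTorsion.one_tmul_eq_sum (hπ (w (e j)))]
    simp_rw [← hv.realBasis_apply]
    rw [Module.Basis.repr_sum_self]
    rfl
  have hgram : (LinearMap.BilinForm.toMatrix bw B).det =
      (A.det : ℝ) ^ 2 * (LinearMap.BilinForm.toMatrix hv.realBasis B).det := by
    have h1 : (LinearMap.BilinForm.toMatrix bw B).det =
        (LinearMap.BilinForm.toMatrix (bw.reindex e.symm) B).det := by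
      rw [← Matrix.det_submatrix_equiv_self e]
      congr 1
      ext i j
      simp [LinearMap.BilinForm.toMatrix_apply]
    rw [h1, ← LinearMap.BilinForm.toMatrix_mul_basis_toMatrix hv.realBasis, Matrix.det_mul,
      Matrix.det_mul, Matrix.det_transpose, hA]
    have : (A.map (Int.castRingHom ℝ)).det = (A.det : ℝ) :=
      ((Int.castRingHom ℝ).map_det A).symm
    rw [this]
    ring
  have hdet := LinearMap.BilinForm.toMatrix_det_ne_zero_of_pos hpos bw
  have hdet' := LinearMap.BilinForm.toMatrix_det_ne_zero_of_pos hpos hv.realBasis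
  have hA0 : (A.det : ℝ) ≠ 0 := fun h0 => hdet (by rw [hgram, h0]; ring)
  have hT : (Nat.card (Submodule.torsion ℤ M) : ℝ) ≠ 0 := by
    have := finite_torsion M
    exact_mod_cast Nat.card_pos.ne'
  have hindex' : ((Submodule.span ℤ (Set.range w)).toAddSubgroup.index : ℝ) =
      Nat.card (Submodule.torsion ℤ M) * |(A.det : ℝ)| := by
    rw [hindex, Nat.cast_mul, Nat.cast_natAbs, Int.cast_abs]
    rfl
  rw [h, hindex', hgram, Real.log_mul (pow_ne_zero 2 hA0) hdet', Real.log_pow,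
    Real.log_mul hT (abs_ne_zero.mpr hA0), Real.log_abs]
  congr 1
  push_cast
  ring

end Index

section ExactSequence

section LinearAlgebra

variable {U V W : Type*} [AddCommGroup U] [AddCommGroup V] [AddCommGroup W]
  [Module ℝ U] [Module ℝ V] [Module ℝ W] {B : LinearMap.BilinForm ℝ V} {f : W →ₗ[ℝ] V} {g : V →ₗ[ℝ] U}

/-- A surjection from a Euclidean space has a section orthogonal to its kernel. -/
lemma exists_orthogonal_section [FiniteDimensional ℝ V] (hsymm : ∀ x y, B x y = B y x)
    (hpos : ∀ x, x ≠ 0 → 0 < B x x) (hfg : Function.Exact f g) (hg : Function.Surjective g) :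
    ∃ s : U →ₗ[ℝ] V, (∀ u, g (s u) = u) ∧ ∀ w u, B (f w) (s u) = 0 := by
  have hrefl : B.IsRefl := fun x y h => by rw [hsymm, h]
  have hcompl : IsCompl (LinearMap.range f) (B.orthogonal (LinearMap.range f)) := by
    rw [LinearMap.BilinForm.isCompl_orthogonal_iff_disjoint hrefl, Submodule.disjoint_def]
    intro x hx hx'
    by_contra h
    exact (hpos x h).ne' (hx' x hx)
  obtain ⟨s, hs⟩ := g.exists_rightInverse_of_surjective (LinearMap.range_eq_top.mpr hg)
  refine ⟨Submodule.projection _ _ hcompl.symm ∘ₗ s, fun u => ?_, fun w u => ?_⟩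
  · have h := Submodule.sub_projection_mem hcompl.symm (s u)
    obtain ⟨w, hw⟩ := h
    have h' : g (s u - Submodule.projection _ _ hcompl.symm (s u)) = 0 := by
      rw [← hw]
      exact hfg.apply_apply_eq_zero w
    rw [map_sub, sub_eq_zero] at h'
    rw [LinearMap.comp_apply, ← h']
    exact LinearMap.congr_fun hs u
  · exact Submodule.projection_apply_mem hcompl.symm (s u) _ ⟨w, rfl⟩

/-- The quotient seminorm is computed by the orthogonal section. -/
lemma sInf_sqrt_fiber_eq (hsymm : ∀ x y, B x y = B y x)
    (hnonneg : ∀ x, 0 ≤ B x x) (hfg : Function.Exact f g) {s : U →ₗ[ℝ] V}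
    (hs : ∀ u, g (s u) = u) (horth : ∀ w u, B (f w) (s u) = 0) (u : U) :
    sInf ((fun v => Real.sqrt (B v v)) '' (g ⁻¹' {u})) = Real.sqrt (B (s u) (s u)) := by
  refine IsLeast.csInf_eq ⟨⟨s u, hs u, rfl⟩, ?_⟩
  rintro _ ⟨v, hv, rfl⟩
  have hv' : g v = u := hv
  obtain ⟨w, hw⟩ := (hfg (v - s u)).mp (by rw [map_sub, hs, hv', sub_self])
  obtain rfl : v = f w + s u := by rw [hw, sub_add_cancel]
  apply Real.sqrt_le_sqrt
  have : B (f w + s u) (f w + s u) = B (f w) (f w) + B (s u) (s u) := by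
    simp only [map_add, LinearMap.add_apply, horth, hsymm (s u) (f w)]
    ring
  rw [this]
  exact le_add_of_nonneg_left (hnonneg _)

/-- Gram determinants are multiplicative in short exact sequences. -/
lemma det_toMatrix_eq_mul_of_exact {ι κ : Type*} [Fintype ι] [Fintype κ] [DecidableEq ι]
    [DecidableEq κ] (hsymm : ∀ x y, B x y = B y x) (hfg : Function.Exact f g) {s : U →ₗ[ℝ] V}
    (hs : ∀ u, g (s u) = u) (horth : ∀ w u, B (f w) (s u) = 0)
    (bW : Module.Basis ι ℝ W) (bU : Module.Basis κ ℝ U) (bV : Module.Basis (ι ⊕ κ) ℝ V)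
    (hl : ∀ i, bV (Sum.inl i) = f (bW i)) (hr : ∀ j, g (bV (Sum.inr j)) = bU j) :
    (LinearMap.BilinForm.toMatrix bV B).det = (LinearMap.BilinForm.toMatrix bW (B.compl₁₂ f f)).det *
      (LinearMap.BilinForm.toMatrix bU (B.compl₁₂ s s)).det := by
  have hn : ∀ j, ∃ w, f w = bV (Sum.inr j) - s (bU j) := fun j =>
    (hfg _).mp (by rw [map_sub, hs, hr, sub_self])
  choose n hn using hn
  have hn' : ∀ j, bV (Sum.inr j) = s (bU j) + f (n j) := fun j => by rw [hn]; abel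
  set A := LinearMap.BilinForm.toMatrix bW (B.compl₁₂ f f) with hA
  set D := LinearMap.BilinForm.toMatrix bU (B.compl₁₂ s s) with hD
  let C : Matrix ι κ ℝ := Matrix.of fun i j => bW.repr (n j) i
  have hfn : ∀ j, f (n j) = ∑ l, C l j • f (bW l) := fun j => by
    conv_lhs => rw [← bW.sum_repr (n j), map_sum]
    simp [C]
  have hAC : ∀ i j, (A * C) i j = B (f (bW i)) (f (n j)) := fun i j => by
    rw [hfn, map_sum, Matrix.mul_apply]
    exact Finset.sum_congr rfl fun l _ => by
      simp [hA, LinearMap.BilinForm.toMatrix_apply, mul_comm]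
  have hblocks : LinearMap.BilinForm.toMatrix bV B =
      Matrix.fromBlocks 1 0 C.transpose 1 * Matrix.fromBlocks A (A * C) 0 D := by
    rw [Matrix.fromBlocks_multiply]
    ext (i | i) (j | j)
    · simp [LinearMap.BilinForm.toMatrix_apply, hl, hA]
    · simp [LinearMap.BilinForm.toMatrix_apply, hl, hAC, hn', horth]
    · simp only [LinearMap.BilinForm.toMatrix_apply, hl, hn', map_add, LinearMap.add_apply,
        Matrix.fromBlocks_apply₂₁, Matrix.mul_zero, add_zero]
      rw [hsymm (s _), horth, zero_add, hfn, map_sum, LinearMap.sum_apply, Matrix.mul_apply]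
      exact Finset.sum_congr rfl fun l _ => by
        simp [hA, LinearMap.BilinForm.toMatrix_apply]
    · simp only [LinearMap.BilinForm.toMatrix_apply, hn', map_add, LinearMap.add_apply,
        Matrix.fromBlocks_apply₂₂, Matrix.one_mul, Matrix.add_apply, horth,
        hsymm (s _) (f _), zero_add, add_zero]
      rw [add_comm, Matrix.mul_apply, hfn i, map_sum, LinearMap.sum_apply]
      congr 1
      · exact Finset.sum_congr rfl fun l _ => by simp [hAC]
      · simp [hD, LinearMap.BilinForm.toMatrix_apply]
  rw [hblocks, Matrix.det_mul, Matrix.det_fromBlocks_zero₁₂, Matrix.det_fromBlocks_zero₂₁]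
  simp

end LinearAlgebra

variable {N M Q : Type*} [AddCommGroup N] [AddCommGroup M] [AddCommGroup Q]
  {f : N →ₗ[ℤ] M} {g : M →ₗ[ℤ] Q} {ι κ : Type*} [Fintype ι] [Fintype κ]
  {a : ι → N} {b : κ → Q} {c : κ → M}

lemma linearIndependent_sumElim_of_exact (hf : Function.Injective f) (hfg : Function.Exact f g)
    (ha : LinearIndependent ℤ a) (hb : LinearIndependent ℤ b) (hc : ∀ j, g (c j) = b j) :
    LinearIndependent ℤ (Sum.elim (f ∘ a) c) := by
  rw [Fintype.linearIndependent_iff] at ha hb ⊢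
  intro d hd
  simp only [Fintype.sum_sum_type, Sum.elim_inl, Sum.elim_inr, Function.comp_apply] at hd
  have hr : ∀ j, d (Sum.inr j) = 0 := by
    refine hb _ ?_
    simpa [hfg.apply_apply_eq_zero, hc] using congrArg g hd
  have hl : ∀ i, d (Sum.inl i) = 0 := by
    refine ha _ (hf ?_)
    simpa [hr] using hd
  exact fun i => i.casesOn hl hr

lemma index_span_sumElim_of_exact (hf : Function.Injective f) (hg : Function.Surjective g)
    (hfg : Function.Exact f g) (hb : LinearIndependent ℤ b) (hc : ∀ j, g (c j) = b j) :
    (Submodule.span ℤ (Set.range (Sum.elim (f ∘ a) c))).toAddSubgroup.index =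
      (Submodule.span ℤ (Set.range a)).toAddSubgroup.index *
        (Submodule.span ℤ (Set.range b)).toAddSubgroup.index := by
  have hfg' : f.toAddMonoidHom.range = g.toAddMonoidHom.ker := by
    ext x
    exact (hfg x).symm
  rw [AddSubgroup.index_eq_index_comap_mul_index_map (g := g.toAddMonoidHom) hg hfg']
  congr 2
  · ext x
    change f x ∈ Submodule.span ℤ _ ↔ x ∈ Submodule.span ℤ _
    rw [Submodule.mem_span_range_iff_exists_fun, Submodule.mem_span_range_iff_exists_fun]
    constructor
    · rintro ⟨d, hd⟩
      simp only [Fintype.sum_sum_type, Sum.elim_inl, Sum.elim_inr, Function.comp_apply] at hd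
      have hr : ∀ j, d (Sum.inr j) = 0 := by
        refine Fintype.linearIndependent_iff.mp hb _ ?_
        simpa [hfg.apply_apply_eq_zero, hc] using congrArg g hd
      refine ⟨fun i => d (Sum.inl i), hf ?_⟩
      simpa [hr] using hd
    · rintro ⟨d, rfl⟩
      exact ⟨Sum.elim d 0, by simp⟩
  · have hmap : Submodule.map g (Submodule.span ℤ (Set.range (Sum.elim (f ∘ a) c))) =
        Submodule.span ℤ (Set.range b) := by
      have hcb : g ∘ c = b := funext hc
      have hfa : Set.range (g ∘ f ∘ a) ⊆ {0} := by
        rintro _ ⟨i, rfl⟩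
        exact hfg.apply_apply_eq_zero _
      rw [Submodule.map_span, ← Set.range_comp, Sum.comp_elim, Set.Sum.elim_range,
        Submodule.span_union, hcb, Submodule.span_eq_bot.mpr hfa, bot_sup_eq]
    rw [← hmap]
    rfl

/-- The arithmetic degree is additive in short exact sequences. -/
theorem chiHat_eq_add_of_exact [Module.Finite ℤ M] (hf : Function.Injective f)
    (hg : Function.Surjective g) (hfg : Function.Exact f g) {nrm : (ℝ ⊗[ℤ] M) → ℝ}
    (hnrm : IsHilbertianSeminorm M nrm) :
    chiHat M nrm = chiHat N (fun v => nrm (f.lTensor ℝ v)) +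
      chiHat Q (fun p => sInf (nrm '' (g.lTensor ℝ ⁻¹' {p}))) := by
  obtain ⟨B, hsymm, hnonneg, hB⟩ := hnrm
  let F : ℝ ⊗[ℤ] N →ₗ[ℝ] ℝ ⊗[ℤ] M := f.baseChange ℝ
  let G : ℝ ⊗[ℤ] M →ₗ[ℝ] ℝ ⊗[ℤ] Q := g.baseChange ℝ
  have hF : Function.Injective F := Module.Flat.lTensor_preserves_injective_linearMap f hf
  have hG : Function.Surjective G := LinearMap.lTensor_surjective ℝ hg
  have hFG : Function.Exact F G := lTensor_exact ℝ hfg hg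
  by_cases hdef : ∃ x, x ≠ 0 ∧ nrm x = 0
  · obtain ⟨x, hx, hx0⟩ := hdef
    rw [chiHat_eq_top hx hx0]
    by_cases hgx : G x = 0
    · obtain ⟨y, rfl⟩ := (hFG x).mp hgx
      have hy : y ≠ 0 := fun h => hx (by rw [h, map_zero])
      rw [chiHat_eq_top hy hx0, EReal.top_add_of_ne_bot (chiHat_ne_bot _)]
    · have hq : sInf (nrm '' (g.lTensor ℝ ⁻¹' {G x})) = 0 := by
        refine IsLeast.csInf_eq ⟨⟨x, rfl, hx0⟩, ?_⟩
        rintro _ ⟨v, -, rfl⟩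
        rw [hB]
        exact Real.sqrt_nonneg _
      rw [chiHat_eq_top (M := Q) hgx hq, EReal.add_top_of_ne_bot (chiHat_ne_bot _)]
  have hpos : ∀ x, x ≠ 0 → 0 < B x x := fun x hx =>
    (hnonneg x).lt_of_ne fun h => hdef ⟨x, hx, by rw [hB, ← h, Real.sqrt_zero]⟩
  obtain ⟨s, hs, horth⟩ := exists_orthogonal_section hsymm hpos hFG hG
  have : IsNoetherian ℤ M := isNoetherian_of_isNoetherianRing_of_finite ℤ M
  have : Module.Finite ℤ N := Module.Finite.of_injective f hf
  have : Module.Finite ℤ Q := Module.Finite.of_surjective g hg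
  obtain ⟨n, a, ha⟩ := exists_isBasisModTorsion N
  obtain ⟨m, b, hb⟩ := exists_isBasisModTorsion Q
  choose c hc using fun j => hg (b j)
  have hli := linearIndependent_sumElim_of_exact hf hfg ha.linearIndependent hb.linearIndependent hc
  have hspan : ⊤ ≤ Submodule.span ℝ (Set.range fun i => (1 : ℝ) ⊗ₜ[ℤ] Sum.elim (f ∘ a) c i) := by
    rintro x -
    set S := Submodule.span ℝ (Set.range fun i => (1 : ℝ) ⊗ₜ[ℤ] Sum.elim (f ∘ a) c i)
    let z := ∑ j, hb.realBasis.repr (G x) j • ((1 : ℝ) ⊗ₜ[ℤ] c j)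
    have hz : G z = G x := by
      conv_rhs => rw [← hb.realBasis.sum_repr (G x)]
      simp [z, G, hc]
    obtain ⟨y, hy⟩ := (hFG (x - z)).mp (by rw [map_sub, hz, sub_self])
    rw [← sub_add_cancel x z, ← hy]
    refine add_mem ?_ (Submodule.sum_mem _ fun j _ =>
      Submodule.smul_mem _ _ (Submodule.subset_span ⟨Sum.inr j, rfl⟩))
    rw [← ha.realBasis.sum_repr y, map_sum]
    refine Submodule.sum_mem _ fun i _ => ?_
    rw [map_smul, ha.realBasis_apply]
    exact Submodule.smul_mem _ _ (Submodule.subset_span ⟨Sum.inl i, by simp [F]⟩)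
  let bw := Module.Basis.mk (Module.Flat.linearIndependent_one_tmul (S := ℝ) hli) hspan
  have hbw : ∀ i, bw i = (1 : ℝ) ⊗ₜ[ℤ] Sum.elim (f ∘ a) c i := fun i => by simp [bw]
  have hposN : ∀ y, y ≠ 0 → 0 < B.compl₁₂ F F y y := fun y hy =>
    hpos _ ((map_ne_zero_iff F hF).mpr hy)
  have hposQ : ∀ u, u ≠ 0 → 0 < B.compl₁₂ s s u u := fun u hu =>
    hpos _ fun h => hu (by rw [← hs u, h, map_zero])
  have hquot : ∀ u, sInf (nrm '' (g.lTensor ℝ ⁻¹' {u})) = Real.sqrt (B.compl₁₂ s s u u) :=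
    fun u => by
      rw [funext hB]
      exact sInf_sqrt_fiber_eq hsymm hnonneg hFG hs horth u
  have hdet := det_toMatrix_eq_mul_of_exact hsymm hFG hs horth ha.realBasis hb.realBasis bw
    (fun i => by simp [hbw, F]) (fun j => by simp [hbw, G, hc])
  have hindex := index_span_sumElim_of_exact (a := a) hf hg hfg hb.linearIndependent hc
  have hdetN := LinearMap.BilinForm.toMatrix_det_ne_zero_of_pos hposN ha.realBasis
  have hdetQ := LinearMap.BilinForm.toMatrix_det_ne_zero_of_pos hposQ hb.realBasis
  have hrestr : ∀ y, nrm (f.lTensor ℝ y) = Real.sqrt (B.compl₁₂ F F y y) := fun y => hB _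
  rw [chiHat_eq_of_basis hsymm hpos hB bw hbw,
    chiHat_eq_of_basis (B := B.compl₁₂ F F) (fun x y => hsymm _ _) hposN hrestr
      ha.realBasis ha.realBasis_apply,
    chiHat_eq_of_basis (B := B.compl₁₂ s s) (fun x y => hsymm _ _) hposQ hquot
      hb.realBasis hb.realBasis_apply,
    hdet, hindex, Real.log_mul hdetN hdetQ, Nat.cast_mul,
    Real.log_mul (Nat.cast_ne_zero.mpr ha.index_span_ne_zero)
      (Nat.cast_ne_zero.mpr hb.index_span_ne_zero), ← EReal.coe_add]
  congr 1
  ring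

end ExactSequence

lemma IsHilbertianSeminorm.comp_lTensor {N M : Type*} [AddCommGroup N] [AddCommGroup M]
    {nrm : (ℝ ⊗[ℤ] M) → ℝ} (hnrm : IsHilbertianSeminorm M nrm) (f : N →ₗ[ℤ] M) :
    IsHilbertianSeminorm N (fun v => nrm (f.lTensor ℝ v)) := by
  obtain ⟨B, hsymm, hnonneg, hB⟩ := hnrm
  exact ⟨B.compl₁₂ (f.baseChange ℝ) (f.baseChange ℝ), fun _ _ => hsymm _ _, fun _ => hnonneg _,
    fun _ => hB _⟩

/-- The arithmetic degree of the top step of a filtration is the sum of those of its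
subquotients. -/
lemma chiHat_last_eq_sum {M : Type*} [AddCommGroup M] [Module.Finite ℤ M]
    {nrm : (ℝ ⊗[ℤ] M) → ℝ} (hnrm : IsHilbertianSeminorm M nrm)
    (k : ℕ) (F : Fin (k + 1) → Submodule ℤ M) (hF : Monotone F) (hbot : F 0 = ⊥) :
    chiHat (F (Fin.last k)) (fun v => nrm
        (LinearMap.lTensor ℝ (F (Fin.last k)).subtype.toAddMonoidHom.toIntLinearMap v))
      = ∑ i : Fin k,
          chiHat (↥(F i.succ) ⧸ (F i.castSucc).comap (F i.succ).subtype)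
            (fun p => sInf
              ((fun v => nrm
                  (LinearMap.lTensor ℝ (F i.succ).subtype.toAddMonoidHom.toIntLinearMap v)) ''
                (LinearMap.lTensor ℝ
                  ((F i.castSucc).comap
                    (F i.succ).subtype).mkQ.toAddMonoidHom.toIntLinearMap ⁻¹' {p}))) := by
  induction k with
  | zero =>
    have : Subsingleton (F (Fin.last 0)) := by
      rw [Submodule.subsingleton_iff_eq_bot]
      exact hbot
    rw [chiHat_of_subsingleton, Finset.univ_eq_empty, Finset.sum_empty]
  | succ k ih =>
    rw [Fin.sum_univ_castSucc]
    have hle : F (Fin.last k).castSucc ≤ F (Fin.last k).succ := hF (Fin.castSucc_lt_succ).le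
    have hfin : Module.Finite ℤ (F (Fin.last k).succ) :=
      Module.IsNoetherian.finite ℤ _
    have hfin' : @Module.Finite ℤ (F (Fin.last k).succ) _ _ (AddCommGroup.toIntModule _) := by
      convert hfin
    have hstep := chiHat_eq_add_of_exact
      (f := (Submodule.inclusion hle).toAddMonoidHom.toIntLinearMap)
      (g := ((F (Fin.last k).castSucc).comap
        (F (Fin.last k).succ).subtype).mkQ.toAddMonoidHom.toIntLinearMap)
      (Submodule.inclusion_injective hle) (Submodule.mkQ_surjective _)
      (fun x => by
        change Submodule.mkQ _ x = 0 ↔ _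
        rw [← LinearMap.mem_ker, Submodule.ker_mkQ]
        exact ⟨fun hx => ⟨⟨x, hx⟩, rfl⟩, fun ⟨y, hy⟩ => hy ▸ y.2⟩)
      (hnrm.comp_lTensor (F (Fin.last k).succ).subtype.toAddMonoidHom.toIntLinearMap)
    refine hstep.trans (congrArg₂ _ ?_ rfl)
    refine Eq.trans ?_ (ih (fun i => F i.castSucc)
      (fun i j h => hF (Fin.castSucc_le_castSucc_iff.mpr h)) hbot)
    congr 1
    funext v
    rw [← LinearMap.lTensor_comp_apply]
    rfl

/-- **Additivity of the arithmetic degree in filtrations.**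
Let `M` be a finitely generated `ℤ`-module with a Hilbertian seminorm `‖·‖` on `M ⊗ ℝ`, and
let `0 = F_0 ⊆ F_1 ⊆ … ⊆ F_k = M` be a filtration of `M` by submodules. Endowing each
subquotient `F_{i+1}/F_i` with the subquotient seminorm (restrict `‖·‖` to `F_{i+1} ⊗ ℝ`,
then take the quotient seminorm on `(F_{i+1} ⊗ ℝ)/(F_i ⊗ ℝ) ≅ (F_{i+1}/F_i) ⊗ ℝ`), one has
`χ̂(M, ‖·‖) = Σ_{i=0}^{k-1} χ̂(F_{i+1}/F_i, ‖·‖_sq)` in `ℝ ∪ {+∞}`. -/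
theorem chiHat_eq_sum_of_filtration (M : Type*) [AddCommGroup M] [Module.Finite ℤ M]
    (nrm : (ℝ ⊗[ℤ] M) → ℝ) (hnrm : IsHilbertianSeminorm M nrm)
    (k : ℕ) (F : Fin (k + 1) → Submodule ℤ M) (hF : Monotone F)
    (hbot : F 0 = ⊥) (htop : F (Fin.last k) = ⊤) :
    chiHat M nrm
      = ∑ i : Fin k,
          chiHat (↥(F i.succ) ⧸ (F i.castSucc).comap (F i.succ).subtype)
            (fun p => sInf
              ((fun v => nrm
                  (LinearMap.lTensor ℝ (F i.succ).subtype.toAddMonoidHom.toIntLinearMap v)) ''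
                (LinearMap.lTensor ℝ
                  ((F i.castSucc).comap
                    (F i.succ).subtype).mkQ.toAddMonoidHom.toIntLinearMap ⁻¹' {p}))) := by
  rw [← chiHat_last_eq_sum hnrm k F hF hbot]
  have h := chiHat_eq_add_of_exact (f := (F (Fin.last k)).subtype.toAddMonoidHom.toIntLinearMap)
    (g := (0 : M →ₗ[ℤ] PUnit)) (Submodule.subtype_injective _)
    (fun y => ⟨0, Subsingleton.elim _ _⟩)
    (fun x => ⟨fun _ => ⟨⟨x, htop ▸ Submodule.mem_top⟩, rfl⟩, fun _ => rfl⟩) hnrm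
  rw [h, chiHat_of_subsingleton (M := PUnit), add_zero]
end

section
/- Let A_• be a commutative ℕ-graded ring that is a ℤ-algebra generated by finitely many elements of degree 1, of Krull dimension d. Let M_• = ⊕_{n∈ℕ} M_n be a finitely generated graded A_•-module (so each M_n is a finitely generated ℤ-module). Let r ≥ d be an integer. Suppose given two families of Hilbertian seminorms: for each i ∈ ℕ and each n ∈ ℕ a Hilbertian seminorm ‖·‖_{i,n} on M_n ⊗ ℝ with ‖·‖_{i+1,n} ≤ ‖·‖_{i,n} for all i, n, and similarly a decreasing-in-j family ‖·‖′_{j,n}; assume they are mutually dominated: for every i there exist j and C > 0 with ‖·‖′_{j,n} ≤ C·‖·‖_{i,n} on M_n ⊗ ℝ for all n, and for every j there exist i and C > 0 with ‖·‖_{i,n} ≤ C·‖·‖′_{j,n} for all n. Then lim_{i→∞} limsup_{n→∞} (r!/n^r)·χ̂(M_n, ‖·‖_{i,n}) = lim_{j→∞} limsup_{n→∞} (r!/n^r)·χ̂(M_n, ‖·‖′_{j,n}), where both limits over i (resp. j) exist in ℝ ∪ {±∞} because the quantity χ̂(M_n, ‖·‖_{i,n}) is nondecreasing in i. -/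
open scoped TensorProduct

section Growth

open scoped nonZeroDivisors

theorem finrank_restrictDegree_le (K : Type*) [Field K] (e m : ℕ) :
    Module.finrank K (MvPolynomial.restrictDegree (Fin e) K m) ≤ (m + 1) ^ e := by
  have b := MvPolynomial.basisRestrictSupport K {n : Fin e →₀ ℕ | ∀ i, n i ≤ m}
  let f : {n : Fin e →₀ ℕ | ∀ i, n i ≤ m} → (Fin e → Fin (m + 1)) :=
    fun n i => ⟨n.1 i, Nat.lt_succ_of_le (n.2 i)⟩
  have hf : Function.Injective f := by
    intro a b h
    ext i
    exact congrArg Fin.val (congrFun h i)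
  have : Fintype {n : Fin e →₀ ℕ | ∀ i, n i ≤ m} := Fintype.ofInjective f hf
  refine (Module.finrank_eq_card_basis b).trans_le ?_
  simpa using Fintype.card_le_of_injective f hf

theorem mul_mem_restrictDegree {K σ : Type*} [Field K] {a b : ℕ} {p q : MvPolynomial σ K}
    (hp : p ∈ MvPolynomial.restrictDegree σ K a) (hq : q ∈ MvPolynomial.restrictDegree σ K b) :
    p * q ∈ MvPolynomial.restrictDegree σ K (a + b) := by
  classical
  rw [MvPolynomial.mem_restrictDegree_iff_sup] at *
  intro i
  have h := MvPolynomial.degreeOf_mul_le i p q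
  simp only [MvPolynomial.degreeOf_def] at h
  exact h.trans (add_le_add (hp i) (hq i))

theorem mem_restrictDegree_totalDegree {K σ : Type*} [Field K] {p : MvPolynomial σ K} {m : ℕ}
    (h : p.totalDegree ≤ m) : p ∈ MvPolynomial.restrictDegree σ K m :=
  MvPolynomial.restrictTotalDegree_le_restrictDegree _ _ _
    ((MvPolynomial.mem_restrictTotalDegree _ _ _).2 h)

/-- In an algebra finite over a polynomial ring in `e` variables, the powers of a
finite-dimensional subspace grow at most like a polynomial of degree `e`. -/
theorem exists_finrank_pow_le {K B : Type*} [Field K] [CommRing B] [Algebra K B] {e : ℕ}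
    (g : MvPolynomial (Fin e) K →ₐ[K] B) (hg : g.Finite) (W : Submodule K B) (hW : W.FG) :
    ∃ C : ℕ, ∀ n : ℕ, Module.finrank K ↥(W ^ n) ≤ C * (n + 1) ^ e := by
  classical
  let _ := g.toRingHom.toAlgebra
  have hfin : Module.Finite (MvPolynomial (Fin e) K) B := hg
  obtain ⟨T, hT⟩ := hfin.fg_top
  have hrep : ∀ b : B, ∃ c : T → MvPolynomial (Fin e) K, b = ∑ t, g (c t) * t := by
    intro b
    have hb : b ∈ Submodule.span (MvPolynomial (Fin e) K) (T : Set B) := hT ▸ Submodule.mem_top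
    obtain ⟨c, hc⟩ := Submodule.mem_span_finset'.1 hb
    exact ⟨c, hc.symm⟩
  choose c hc using hrep
  obtain ⟨S, rfl⟩ := hW
  obtain ⟨D, hD⟩ : ∃ D : ℕ, ∀ s ∈ S, ∀ t t' : T, (c (s * t) t').totalDegree ≤ D := by
    refine ⟨S.sup fun s => Finset.univ.sup fun t : T => Finset.univ.sup fun t' : T =>
      (c (s * t) t').totalDegree, fun s hs t t' => ?_⟩
    refine le_trans ?_ (Finset.le_sup (f := fun s => Finset.univ.sup fun t : T =>
      Finset.univ.sup fun t' : T => (c (s * t) t').totalDegree) hs)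
    refine le_trans ?_ (Finset.le_sup (f := fun t : T =>
      Finset.univ.sup fun t' : T => (c (s * t) t').totalDegree) (Finset.mem_univ t))
    exact Finset.le_sup (f := fun t' : T => (c (s * t) t').totalDegree) (Finset.mem_univ t')
  obtain ⟨D₀, hD₀⟩ : ∃ D₀ : ℕ, ∀ t : T, (c 1 t).totalDegree ≤ D₀ :=
    ⟨Finset.univ.sup fun t : T => (c 1 t).totalDegree, fun t =>
      Finset.le_sup (f := fun t : T => (c 1 t).totalDegree) (Finset.mem_univ t)⟩
  let F : ℕ → Submodule K (T → MvPolynomial (Fin e) K) := fun m =>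
    Submodule.pi Set.univ fun _ => MvPolynomial.restrictDegree (Fin e) K m
  let Φ : (T → MvPolynomial (Fin e) K) →ₗ[K] B :=
    ∑ t : T, (LinearMap.mulRight K (t : B)) ∘ₗ g.toLinearMap ∘ₗ LinearMap.proj t
  have hΦ : ∀ f, Φ f = ∑ t, g (f t) * t := fun f => by simp [Φ]
  have hle : ∀ n : ℕ, Submodule.span K (S : Set B) ^ n ≤ (F (D₀ + n * D)).map Φ := by
    intro n
    induction n with
    | zero =>
      rw [pow_zero, Submodule.one_le]
      refine ⟨c 1, fun t _ => mem_restrictDegree_totalDegree (by simpa using hD₀ t), ?_⟩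
      rw [hΦ, ← hc]
    | succ n ih =>
      rw [pow_succ']
      refine (mul_le_mul' le_rfl ih).trans ?_
      rw [Submodule.mul_le]
      intro w hw x hx
      obtain ⟨f, hf, rfl⟩ := hx
      refine Submodule.span_induction (p := fun w _ => w * Φ f ∈ (F (D₀ + (n + 1) * D)).map Φ)
        ?_ ?_ ?_ ?_ hw
      · intro s hs
        refine ⟨fun t' => ∑ t, f t * c (s * t) t',
          fun t' _ => Submodule.sum_mem _ fun t _ => ?_, ?_⟩
        · have := mul_mem_restrictDegree (hf t trivial)
            (mem_restrictDegree_totalDegree (hD s hs t t'))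
          rwa [show D₀ + (n + 1) * D = D₀ + n * D + D by ring]
        · simp only [hΦ, map_sum, map_mul, Finset.sum_mul, Finset.mul_sum]
          rw [Finset.sum_comm]
          refine Finset.sum_congr rfl fun t _ => ?_
          rw [mul_left_comm]
          conv_rhs => rw [hc (s * t), Finset.mul_sum]
          exact Finset.sum_congr rfl fun t' _ => by ring
      · simp
      · intro x y _ _ hx hy
        rw [add_mul x y]
        exact Submodule.add_mem _ hx hy
      · intro a x _ hx
        rw [smul_mul_assoc]
        exact Submodule.smul_mem _ _ hx
  have hFeq : ∀ m, Nonempty (↥(F m) ≃ₗ[K] (T → MvPolynomial.restrictDegree (Fin e) K m)) := by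
    intro m
    exact ⟨{ toFun := fun f t => ⟨f.1 t, f.2 t trivial⟩
             invFun := fun f => ⟨fun t => (f t).1, fun t _ => (f t).2⟩
             map_add' := fun _ _ => rfl
             map_smul' := fun _ _ => rfl
             left_inv := fun _ => rfl
             right_inv := fun _ => rfl }⟩
  refine ⟨T.card * (D₀ + D + 1) ^ e, fun n => ?_⟩
  obtain ⟨E⟩ := hFeq (D₀ + n * D)
  have : Module.Finite K (F (D₀ + n * D)) := Module.Finite.equiv E.symm
  calc _ ≤ Module.finrank K ↥((F (D₀ + n * D)).map Φ) := Submodule.finrank_mono (hle n)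
    _ ≤ Module.finrank K ↥(F (D₀ + n * D)) := Submodule.finrank_map_le _ _
    _ = T.card * Module.finrank K (MvPolynomial.restrictDegree (Fin e) K (D₀ + n * D)) := by
      rw [E.finrank_eq, Module.finrank_pi_fintype]; simp
    _ ≤ T.card * (D₀ + n * D + 1) ^ e := by gcongr; exact finrank_restrictDegree_le _ _ _
    _ ≤ T.card * ((D₀ + D + 1) * (n + 1)) ^ e := by gcongr; nlinarith [Nat.zero_le (D₀ * n)]
    _ = _ := by rw [mul_pow, mul_assoc]

theorem isJacobsonRing_int : IsJacobsonRing ℤ := by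
  rw [isJacobsonRing_iff_prime_eq]
  intro P hP
  by_cases h : P = ⊥
  · subst h
    refine le_antisymm (fun x hx => ?_) Ideal.le_jacobson
    rw [Ideal.mem_jacobson_bot] at hx
    have := Int.isUnit_iff.1 (hx (2 * x))
    rw [Ideal.mem_bot]
    by_contra h0
    rcases this with h | h <;> nlinarith [mul_self_pos.2 h0]
  · have := hP.isMaximal h
    exact Ideal.jacobson_eq_self_of_isMaximal

/-- The contraction to `ℤ` of a maximal ideal of a finitely generated ring is nonzero. -/
theorem exists_intCast_mem_of_isMaximal {A : Type*} [CommRing A] [Algebra.FiniteType ℤ A]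
    (m : Ideal A) [m.IsMaximal] : ∃ z : ℤ, z ≠ 0 ∧ (z : A) ∈ m := by
  have := isJacobsonRing_int
  let _ := Ideal.Quotient.field m
  have hfin : Module.Finite ℤ (A ⧸ m) := finite_of_finite_type_of_isJacobsonRing ℤ (A ⧸ m)
  by_contra! hcon
  refine Int.not_isField (isField_of_isIntegral_of_isField (S := A ⧸ m) ?_ (Field.toIsField _))
  rw [injective_iff_map_eq_zero]
  intro z hz
  by_contra h0
  refine hcon z h0 ?_
  rw [← Ideal.Quotient.eq_zero_iff_mem]
  simpa using hz

theorem MvPolynomial.exists_ltSeries (K : Type*) [Field K] (e : ℕ) :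
    ∃ l : LTSeries (PrimeSpectrum (MvPolynomial (Fin e) K)), l.length = e := by
  have h : ringKrullDim (MvPolynomial (Fin e) K) = e := by
    simp
  exact Order.le_krullDim_iff.1 h.ge

/-- If the rationalization of a finitely generated ring contains a polynomial ring in `e`
variables over which it is finite, then the ring has dimension at least `e + 1`. -/
theorem add_one_le_ringKrullDim {A : Type*} [CommRing A] [Algebra.FiniteType ℤ A] {e : ℕ}
    (g : MvPolynomial (Fin e) ℚ →ₐ[ℚ] (ℚ ⊗[ℤ] A)) (hinj : Function.Injective g)
    (hg : g.Finite) : ((e + 1 : ℕ) : WithBot ℕ∞) ≤ ringKrullDim A := by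
  let _ := g.toRingHom.toAlgebra
  have hfin : Module.Finite (MvPolynomial (Fin e) ℚ) (ℚ ⊗[ℤ] A) := hg
  have : FaithfulSMul (MvPolynomial (Fin e) ℚ) (ℚ ⊗[ℤ] A) :=
    (faithfulSMul_iff_algebraMap_injective _ _).2 hinj
  obtain ⟨l, hl⟩ := MvPolynomial.exists_ltSeries ℚ e
  obtain ⟨Q, hQ, hQl⟩ := Ideal.nonempty_primesOver (S := ℚ ⊗[ℤ] A) l.head.asIdeal
  obtain ⟨L, hL, -, -⟩ := Ideal.exists_ltSeries_of_hasGoingUp l Q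
  let φ : A →+* ℚ ⊗[ℤ] A := (Algebra.TensorProduct.includeRight : A →ₐ[ℤ] ℚ ⊗[ℤ] A).toRingHom
  have hunit : ∀ z : ℤ, z ≠ 0 → IsUnit (z : ℚ ⊗[ℤ] A) := fun z hz => by
    have : IsUnit (z : ℚ) := (Int.cast_ne_zero.2 hz).isUnit
    simpa using this.map (algebraMap ℚ (ℚ ⊗[ℤ] A))
  have hloc : ∀ b : ℚ ⊗[ℤ] A, ∃ z : ℤ, z ≠ 0 ∧ ∃ a, (z : ℚ ⊗[ℤ] A) * b = φ a := by
    intro b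
    induction b with
    | zero => exact ⟨1, one_ne_zero, 0, by simp⟩
    | tmul q a =>
      refine ⟨q.den, by simp, q.num • a, ?_⟩
      have h1 : ((q.den : ℤ) : ℚ ⊗[ℤ] A) = (q.den : ℚ) ⊗ₜ 1 := by
        rw [Int.cast_natCast]
        exact (map_natCast (algebraMap ℚ (ℚ ⊗[ℤ] A)) q.den).symm
      rw [h1, Algebra.TensorProduct.tmul_mul_tmul, one_mul, Rat.den_mul_eq_num]
      change _ = (1 : ℚ) ⊗ₜ[ℤ] (q.num • a)
      rw [← TensorProduct.smul_tmul]
      simp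
    | add x y hx hy =>
      obtain ⟨z, hz, a, ha⟩ := hx
      obtain ⟨w, hw, b, hb⟩ := hy
      refine ⟨z * w, mul_ne_zero hz hw, w * a + z * b, ?_⟩
      simp only [map_add, map_mul, map_intCast, ← ha, ← hb]
      push_cast
      ring
  have hmono : StrictMono (PrimeSpectrum.comap φ) := by
    intro P P' hlt
    refine lt_of_le_of_ne (Ideal.comap_mono hlt.le) fun heq => hlt.not_ge fun b hb => ?_
    obtain ⟨z, hz, a, ha⟩ := hloc b
    have h1 : a ∈ (PrimeSpectrum.comap φ P').asIdeal := by
      change φ a ∈ P'.asIdeal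
      rw [← ha]
      exact P'.asIdeal.mul_mem_left _ hb
    rw [← heq] at h1
    have h2 : φ a ∈ P.asIdeal := h1
    rw [← ha] at h2
    exact (P.asIdeal.unit_mul_mem_iff_mem (hunit z hz)).1 h2
  let l' := L.map _ hmono
  obtain ⟨m, hm, hle⟩ := Ideal.exists_le_maximal l'.last.asIdeal l'.last.2.ne_top
  obtain ⟨z, hz, hzm⟩ := exists_intCast_mem_of_isMaximal m
  have hlt : l'.last < ⟨m, hm.isPrime⟩ := by
    refine lt_of_le_of_ne hle fun heq => ?_
    have h1 : (z : A) ∈ l'.last.asIdeal := by rw [heq]; exact hzm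
    rw [LTSeries.last_map] at h1
    have h2 : φ (z : A) ∈ L.last.asIdeal := h1
    rw [map_intCast] at h2
    exact L.last.2.ne_top (Ideal.eq_top_of_isUnit_mem _ h2 (hunit z hz))
  have := Order.LTSeries.length_le_krullDim (l'.snoc ⟨m, hm.isPrime⟩ hlt)
  simpa [l', hL, hl, ringKrullDim] using this

/-- In a finitely generated ring of dimension `d`, the ranks of the powers of a finitely generated
subgroup are `O(n ^ (d - 1))`. -/
theorem exists_finrank_pow_le_of_ringKrullDim {A : Type*} [CommRing A] [Algebra.FiniteType ℤ A]
    {d : ℕ} (hd : ringKrullDim A = d) (V : Submodule ℤ A) (hV : V.FG) :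
    ∃ C : ℕ, ∀ n : ℕ, (n + 1) * Module.finrank ℤ ↥(V ^ n) ≤ C * (n + 1) ^ d := by
  let φ : A →ₐ[ℤ] ℚ ⊗[ℤ] A := Algebra.TensorProduct.includeRight
  have : IsLocalizedModule ℤ⁰ φ.toLinearMap :=
    (isLocalizedModule_iff_isBaseChange ℤ⁰ ℚ φ.toLinearMap).2 (TensorProduct.isBaseChange ℤ A ℚ)
  have hrank : ∀ N : Submodule ℤ A, Module.finrank ℤ N =
      Module.finrank ℚ (N.localized' ℚ ℤ⁰ φ.toLinearMap) := by
    intro N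
    rw [IsLocalization.finrank_eq ℚ ℤ⁰ le_rfl,
      IsLocalizedModule.finrank_eq ℤ⁰ (N.toLocalized' ℚ ℤ⁰ φ.toLinearMap) le_rfl]
  rcases subsingleton_or_nontrivial (ℚ ⊗[ℤ] A) with hB | hB
  · exact ⟨0, fun n => by simp [hrank, Module.finrank_zero_of_subsingleton]⟩
  obtain ⟨e, g, hinj, hg⟩ := exists_finite_inj_algHom_of_fg ℚ (ℚ ⊗[ℤ] A)
  have hed : e + 1 ≤ d := by
    have := add_one_le_ringKrullDim g hinj hg
    rw [hd] at this
    exact_mod_cast this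
  obtain ⟨S, rfl⟩ := hV
  have hWfg : (Submodule.span ℚ (φ '' (S : Set A))).FG :=
    Submodule.fg_span (S.finite_toSet.image φ)
  obtain ⟨C, hC⟩ := exists_finrank_pow_le g hg _ hWfg
  refine ⟨C, fun n => ?_⟩
  have heq : (Submodule.span ℤ (S : Set A) ^ n).localized' ℚ ℤ⁰ φ.toLinearMap =
      Submodule.span ℚ (φ '' (S : Set A)) ^ n := by
    rw [Submodule.span_pow, Submodule.span_pow, Submodule.localized'_span, ← Set.image_pow]
    rfl
  rw [hrank, heq]
  calc _ ≤ (n + 1) * (C * (n + 1) ^ e) := Nat.mul_le_mul_left _ (hC n)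
    _ = C * (n + 1) ^ (e + 1) := by ring
    _ ≤ C * (n + 1) ^ d := Nat.mul_le_mul_left _ (Nat.pow_le_pow_right n.succ_pos hed)

theorem finrank_finset_sup_le {R M ι : Type*} [CommRing R] [IsDomain R] [AddCommGroup M]
    [Module R M] (s : Finset ι) (N : ι → Submodule R M) (hN : ∀ i, (N i).FG) :
    Module.finrank R ↥(s.sup N) ≤ ∑ i ∈ s, Module.finrank R (N i) := by
  classical
  induction s using Finset.induction_on with
  | empty => rw [Finset.sup_empty, finrank_bot, Finset.sum_empty]
  | insert i s hi ih =>
    rw [Finset.sup_insert, Finset.sum_insert hi]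
    have h1 : Module.Finite R (N i) := Module.Finite.iff_fg.2 (hN i)
    have h2 : Module.Finite R ↥(s.sup N) :=
      Module.Finite.iff_fg.2 (Submodule.fg_finset_sup s N fun i _ => hN i)
    have h3 : Module.Finite R ↥(N i ⊔ s.sup N) :=
      Module.Finite.iff_fg.2 ((hN i).sup (Module.Finite.iff_fg.1 h2))
    refine le_trans ?_ (Nat.add_le_add_left ih _)
    have := Submodule.rank_add_le_rank_add_rank (N i) (s.sup N)
    rw [← Module.finrank_eq_rank, ← Module.finrank_eq_rank, ← Module.finrank_eq_rank] at this
    exact_mod_cast this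

/-- A graded module finitely generated over a graded ring generated by finitely many elements of
degree `1` is contained, degree by degree, in a sum of boundedly many cyclic images of the powers
of a finitely generated subgroup. -/
theorem exists_graded_le_sup_map_pow {A : Type*} [CommRing A] (𝒜 : ℕ → AddSubgroup A)
    [GradedRing 𝒜] (s : Finset A) (hs : (s : Set A) ⊆ (𝒜 1 : Set A))
    (hgen : Algebra.adjoin ℤ (s : Set A) = ⊤)
    {M : Type*} [AddCommGroup M] [Module A M] [Module.Finite A M]
    (ℳ : ℕ → Submodule ℤ M) [DirectSum.Decomposition ℳ] [SetLike.GradedSMul 𝒜 ℳ] :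
    ∃ Y : Finset M, ∀ n, ℳ n ≤ Y.sup fun y =>
      ((Submodule.span ℤ (insert 1 (s : Set A))) ^ n).map
        ((LinearMap.toSpanSingleton A M y).restrictScalars ℤ) := by
  classical
  set V := Submodule.span ℤ (insert 1 (s : Set A)) with hV
  have hV1 : 1 ≤ V := Submodule.one_le.2 (Submodule.subset_span (Set.mem_insert _ _))
  obtain ⟨G, hG⟩ := (inferInstance : Module.Finite A M).fg_top
  let Y : Finset M := G.biUnion fun g =>
    (DirectSum.decompose ℳ g).support.image fun k => (DirectSum.decompose ℳ g k : M)
  let T : ℕ → Submodule ℤ M := fun n => Y.sup fun y =>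
    (V ^ n).map ((LinearMap.toSpanSingleton A M y).restrictScalars ℤ)
  have hTmono : ∀ {k n}, k ≤ n → T k ≤ T n := fun hkn =>
    Finset.sup_mono_fun fun y _ => Submodule.map_mono (pow_le_pow_right₀ hV1 hkn)
  have hmemT : ∀ {n a y}, a ∈ V ^ n → y ∈ Y → a • y ∈ T n := fun {n a y} ha hy =>
    Finset.le_sup (f := fun y =>
      (V ^ n).map ((LinearMap.toSpanSingleton A M y).restrictScalars ℤ)) hy ⟨a, ha, rfl⟩
  have hmono : ∀ a ∈ Submonoid.closure (s : Set A), ∃ k, a ∈ 𝒜 k ∧ a ∈ V ^ k := by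
    intro a ha
    induction ha using Submonoid.closure_induction with
    | mem x hx =>
      exact ⟨1, hs hx, by simpa using Submodule.subset_span (Set.mem_insert_of_mem _ hx)⟩
    | one => exact ⟨0, SetLike.GradedOne.one_mem, pow_zero V ▸ Submodule.one_le.1 le_rfl⟩
    | mul x y _ _ hx hy =>
      obtain ⟨i, hi, hi'⟩ := hx
      obtain ⟨j, hj, hj'⟩ := hy
      exact ⟨i + j, SetLike.GradedMul.mul_mem hi hj, pow_add V i j ▸ Submodule.mul_mem_mul hi' hj'⟩
  let P : Submodule ℤ M := Submodule.span ℤ {x | ∃ k, x ∈ ℳ k ∧ x ∈ T k}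
  have hPmul : ∀ a : A, ∀ g ∈ G, a • g ∈ P := by
    intro a g hg
    have ha : a ∈ Submodule.span ℤ (Submonoid.closure (s : Set A) : Set A) := by
      rw [← Algebra.adjoin_eq_span, hgen]
      trivial
    induction ha using Submodule.span_induction with
    | mem a ha =>
      obtain ⟨k, hk, hk'⟩ := hmono a ha
      rw [← DirectSum.sum_support_decompose ℳ g, Finset.smul_sum]
      refine Submodule.sum_mem _ fun j hj => Submodule.subset_span ⟨k + j, ?_, ?_⟩
      · have h := SetLike.GradedSMul.smul_mem (A := 𝒜) (B := ℳ) hk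
          (SetLike.coe_mem (DirectSum.decompose ℳ g j))
        rwa [vadd_eq_add] at h
      · exact hTmono (Nat.le_add_right k j) (hmemT hk'
          (Finset.mem_biUnion.2 ⟨g, hg, Finset.mem_image_of_mem _ hj⟩))
    | zero => simp
    | add x y _ _ hx hy => rw [add_smul]; exact P.add_mem hx hy
    | smul z x _ hx => rw [smul_assoc]; exact P.smul_mem _ hx
  have hPtop : ∀ x, x ∈ P := by
    intro x
    have hx : x ∈ Submodule.span A (G : Set M) := hG ▸ Submodule.mem_top
    obtain ⟨c, rfl⟩ := Submodule.mem_span_finset'.1 hx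
    exact Submodule.sum_mem _ fun g _ => hPmul _ _ g.2
  refine ⟨Y, fun n x hx => ?_⟩
  have key : ∀ x ∈ P, (DirectSum.decompose ℳ x n : M) ∈ T n := by
    intro x hx
    induction hx using Submodule.span_induction with
    | mem x hx =>
      obtain ⟨k, hk, hk'⟩ := hx
      by_cases h : k = n
      · subst h
        rwa [DirectSum.decompose_of_mem_same _ hk]
      · rw [DirectSum.decompose_of_mem_ne _ hk h]
        exact Submodule.zero_mem _
    | zero => simp
    | add x y _ _ hx hy => simpa using Submodule.add_mem _ hx hy
    | smul z x _ hx =>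
      rw [DirectSum.decompose_smul]
      exact Submodule.smul_mem _ z hx
  have := key x (hPtop x)
  rwa [DirectSum.decompose_of_mem_same _ hx] at this

theorem exists_finrank_graded_le {A : Type*} [CommRing A] (𝒜 : ℕ → AddSubgroup A)
    [GradedRing 𝒜]
    (hgen : ∃ s : Finset A, (↑s : Set A) ⊆ (𝒜 1 : Set A) ∧ Algebra.adjoin ℤ (↑s : Set A) = ⊤)
    {d : ℕ} (hdim : ringKrullDim A = d)
    {M : Type*} [AddCommGroup M] [Module A M] [Module.Finite A M]
    (ℳ : ℕ → Submodule ℤ M) [DirectSum.Decomposition ℳ] [SetLike.GradedSMul 𝒜 ℳ] :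
    ∃ C : ℕ, ∀ n : ℕ, (n + 1) * Module.finrank ℤ (ℳ n) ≤ C * (n + 1) ^ d := by
  obtain ⟨s, hs, hadj⟩ := hgen
  have : Algebra.FiniteType ℤ A := ⟨⟨s, hadj⟩⟩
  set V := Submodule.span ℤ (insert 1 (s : Set A)) with hVdef
  have hV : V.FG := Submodule.fg_span (s.finite_toSet.insert 1)
  obtain ⟨C, hC⟩ := exists_finrank_pow_le_of_ringKrullDim hdim V hV
  obtain ⟨Y, hY⟩ := exists_graded_le_sup_map_pow 𝒜 s hs hadj ℳ
  refine ⟨Y.card * C, fun n => ?_⟩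
  let N : M → Submodule ℤ M := fun y =>
    (V ^ n).map ((LinearMap.toSpanSingleton A M y).restrictScalars ℤ)
  have hVn : (V ^ n).FG := hV.pow n
  have hVn' : Module.Finite ℤ ↥(V ^ n) := Module.Finite.iff_fg.2 hVn
  have hN : ∀ y, (N y).FG := fun y => hVn.map _
  have hsup : Module.Finite ℤ ↥(Y.sup N) :=
    Module.Finite.iff_fg.2 (Submodule.fg_finset_sup Y N fun y _ => hN y)
  calc (n + 1) * Module.finrank ℤ (ℳ n)
      ≤ (n + 1) * ∑ y ∈ Y, Module.finrank ℤ (N y) := Nat.mul_le_mul_left _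
        ((Submodule.finrank_mono (hY n)).trans (finrank_finset_sup_le Y N hN))
    _ ≤ (n + 1) * ∑ y ∈ Y, Module.finrank ℤ ↥(V ^ n) := Nat.mul_le_mul_left _
        (Finset.sum_le_sum fun y _ => Submodule.finrank_map_le _ _)
    _ = Y.card * ((n + 1) * Module.finrank ℤ ↥(V ^ n)) := by
      rw [Finset.sum_const, smul_eq_mul]; ring
    _ ≤ Y.card * C * (n + 1) ^ d := by
      rw [mul_assoc]; exact Nat.mul_le_mul_left _ (hC n)

end Growth

section Gram

open scoped ComplexOrder MatrixOrder Matrix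

/-- The determinant is monotone for the Loewner order, from a positive definite matrix upwards. -/
theorem Matrix.PosDef.det_le_det {n : Type*} [Fintype n] [DecidableEq n] {G H : Matrix n n ℝ}
    (hG : G.PosDef) (hGH : (H - G).PosSemidef) : G.det ≤ H.det := by
  obtain ⟨B, hB⟩ := CStarAlgebra.nonneg_iff_eq_star_mul_self.1 hG.posSemidef.nonneg
  rw [Matrix.star_eq_conjTranspose] at hB
  have hdet : G.det = B.det * B.det := by
    rw [hB, Matrix.det_mul, Matrix.det_conjTranspose, star_trivial]
  have hB0 : IsUnit B.det := by
    rw [isUnit_iff_ne_zero]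
    intro h
    have := hG.det_pos
    simp [hdet, h] at this
  set T : Matrix n n ℝ := (B⁻¹)ᴴ * (H - G) * B⁻¹ with hT
  have hTpos : T.PosSemidef := hGH.conjTranspose_mul_mul_same _
  have hBT : Bᴴ * (B⁻¹)ᴴ = 1 := by
    rw [← Matrix.conjTranspose_mul, Matrix.nonsing_inv_mul _ hB0, Matrix.conjTranspose_one]
  have hH : H = Bᴴ * (1 + T) * B := by
    have h1 : Bᴴ * T * B = H - G := by
      calc Bᴴ * T * B = (Bᴴ * (B⁻¹)ᴴ) * (H - G) * (B⁻¹ * B) := by simp only [hT, Matrix.mul_assoc]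
        _ = H - G := by rw [hBT, Matrix.nonsing_inv_mul _ hB0, Matrix.one_mul, Matrix.mul_one]
    rw [Matrix.mul_add, Matrix.add_mul, h1, Matrix.mul_one, ← hB]
    abel
  have hT1 : 1 ≤ (1 + T).det := by
    have hherm : (1 + T).IsHermitian := Matrix.isHermitian_one.add hTpos.isHermitian
    rw [hherm.det_eq_prod_eigenvalues]
    refine Finset.prod_induction _ (1 ≤ ·) (fun _ _ => one_le_mul_of_one_le_of_one_le) le_rfl
      fun i _ => ?_
    have hnorm : star ⇑(hherm.eigenvectorBasis i) ⬝ᵥ ⇑(hherm.eigenvectorBasis i) = (1 : ℝ) := by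
      rw [dotProduct_comm, ← EuclideanSpace.inner_eq_star_dotProduct]
      simp
    have := hTpos.dotProduct_mulVec_nonneg ⇑(hherm.eigenvectorBasis i)
    rw [hherm.eigenvalues_eq, Matrix.add_mulVec, Matrix.one_mulVec, dotProduct_add, hnorm]
    simpa using this
  rw [hH, Matrix.det_mul, Matrix.det_mul, Matrix.det_conjTranspose, star_trivial, hdet]
  nlinarith [mul_self_nonneg B.det]

theorem dotProduct_gram_mulVec {ι E : Type*} [Fintype ι] [AddCommGroup E] [Module ℝ E]
    (B : E →ₗ[ℝ] E →ₗ[ℝ] ℝ) (e : ι → E) (x : ι → ℝ) :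
    star x ⬝ᵥ (Matrix.of fun i j => B (e i) (e j)) *ᵥ x = B (∑ i, x i • e i) (∑ i, x i • e i) := by
  simp only [dotProduct, Matrix.mulVec, Matrix.of_apply, map_sum, LinearMap.sum_apply, map_smul,
    LinearMap.smul_apply, smul_eq_mul, star_trivial, Pi.star_apply, Finset.mul_sum]
  rw [Finset.sum_comm]
  exact Finset.sum_congr rfl fun i _ => Finset.sum_congr rfl fun j _ => by ring

/-- Gram determinants of comparable positive forms: if `B' ≤ c B` and `B'` is definite, then
`det B' ≤ c ^ n det B`. -/
theorem det_gram_le {ι E : Type*} [Fintype ι] [DecidableEq ι] [AddCommGroup E] [Module ℝ E]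
    {B B' : E →ₗ[ℝ] E →ₗ[ℝ] ℝ} (hs : ∀ x y, B x y = B y x) (hs' : ∀ x y, B' x y = B' y x)
    (hpos : ∀ x, x ≠ 0 → 0 < B' x x) {c : ℝ} (hle : ∀ x, B' x x ≤ c * B x x)
    {e : ι → E} (he : LinearIndependent ℝ e) :
    0 < (Matrix.of fun i j => B' (e i) (e j)).det ∧
    (Matrix.of fun i j => B' (e i) (e j)).det ≤
      c ^ Fintype.card ι * (Matrix.of fun i j => B (e i) (e j)).det := by
  have hG : (Matrix.of fun i j => B' (e i) (e j)).PosDef := by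
    refine .of_dotProduct_mulVec_pos (Matrix.IsHermitian.ext fun i j => hs' _ _) fun x hx => ?_
    rw [dotProduct_gram_mulVec]
    refine hpos _ fun h => hx (funext (Fintype.linearIndependent_iff.1 he x h))
  refine ⟨hG.det_pos, ?_⟩
  rw [← Matrix.det_smul]
  refine hG.det_le_det (.of_dotProduct_mulVec_nonneg
    (.sub (Matrix.IsHermitian.ext fun i j => ?_) hG.isHermitian) fun x => ?_)
  · simp [hs (e i)]
  · rw [Matrix.sub_mulVec, dotProduct_sub, Matrix.smul_mulVec, dotProduct_smul,
      dotProduct_gram_mulVec, dotProduct_gram_mulVec, smul_eq_mul, sub_nonneg]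
    exact hle _

theorem polarForm_eq {M : Type*} [AddCommGroup M] {nrm : (ℝ ⊗[ℤ] M) → ℝ}
    {B : (ℝ ⊗[ℤ] M) →ₗ[ℝ] (ℝ ⊗[ℤ] M) →ₗ[ℝ] ℝ} (hs : ∀ x y, B x y = B y x)
    (h0 : ∀ x, 0 ≤ B x x) (hB : ∀ x, nrm x = Real.sqrt (B x x)) (x y : ℝ ⊗[ℤ] M) :
    polarForm M nrm x y = B x y := by
  simp only [polarForm, hB, Real.sq_sqrt (h0 _)]
  simp only [map_add, LinearMap.add_apply, hs y x]
  ring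

theorem IsBasisModTorsion.linearIndependent_s3 {M : Type*} [AddCommGroup M] {n : ℕ} {v : Fin n → M}
    (h : IsBasisModTorsion M n v) : LinearIndependent ℤ v :=
  Fintype.linearIndependent_iff.2 fun c hc i => congrFun (h.2 c (hc ▸ Submodule.zero_mem _)) i

/-- If `‖·‖' ≤ C ‖·‖` then the arithmetic degree grows by at most `rank M * log C` when passing from
`‖·‖` to `‖·‖'`. -/
theorem chiHat_le_chiHat_add {M : Type*} [AddCommGroup M] [Module.Finite ℤ M]
    {nrm nrm' : (ℝ ⊗[ℤ] M) → ℝ} (hH : IsHilbertianSeminorm M nrm)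
    (hH' : IsHilbertianSeminorm M nrm') {C : ℝ} (hC : 1 ≤ C)
    (hle : ∀ x, nrm' x ≤ C * nrm x) :
    chiHat M nrm ≤ chiHat M nrm' + ((Module.finrank ℤ M * Real.log C : ℝ) : EReal) := by
  obtain ⟨B, hs, h0, hB⟩ := hH
  obtain ⟨B', hs', h0', hB'⟩ := hH'
  have hlog : 0 ≤ Real.log C := Real.log_nonneg hC
  have hrem : 0 ≤ Module.finrank ℤ M * Real.log C := by positivity
  by_cases hM : Subsingleton M
  · simpa only [chiHat, hM, dif_pos, zero_add] using EReal.coe_nonneg.2 hrem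
  by_cases hdef' : ∃ x : ℝ ⊗[ℤ] M, x ≠ 0 ∧ nrm' x = 0
  · simp only [chiHat, hM, hdef', dif_pos, dif_neg, not_false_eq_true]
    rw [EReal.top_add_coe]
    exact le_top
  have hdef : ¬ ∃ x : ℝ ⊗[ℤ] M, x ≠ 0 ∧ nrm x = 0 := by
    rintro ⟨x, hx, hx0⟩
    refine hdef' ⟨x, hx, le_antisymm ?_ (hB' x ▸ Real.sqrt_nonneg _)⟩
    simpa [hx0] using hle x
  by_cases hb : ∃ (n : ℕ) (v : Fin n → M), IsBasisModTorsion M n v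
  · simp only [chiHat, hM, hdef', hdef, hb, dif_pos, dif_neg, not_false_eq_true]
    rw [← EReal.coe_add, EReal.coe_le_coe_iff]
    have hv := hb.choose_spec.choose_spec.linearIndependent_s3
    generalize hb.choose_spec.choose = v at hv ⊢
    have hcard : hb.choose ≤ Module.finrank ℤ M := by
      simpa using hv.fintype_card_le_finrank
    simp only [polarForm_eq hs h0 hB, polarForm_eq hs' h0' hB']
    obtain ⟨hpos, hdet⟩ := det_gram_le (c := C ^ 2) hs hs'
      (fun x hx => lt_of_le_of_ne (h0' x) fun h => hdef' ⟨x, hx, by rw [hB', ← h, Real.sqrt_zero]⟩)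
      (fun x => by
        have h := pow_le_pow_left₀ (hB' x ▸ Real.sqrt_nonneg _) (hle x) 2
        rwa [mul_pow, hB, hB', Real.sq_sqrt (h0 x), Real.sq_sqrt (h0' x)] at h)
      (Module.Flat.linearIndependent_one_tmul (S := ℝ) hv)
    have hC0 : 0 < (C ^ 2) ^ Fintype.card (Fin hb.choose) := by positivity
    have hpos2 := pos_of_mul_pos_right (hpos.trans_le hdet) hC0.le
    have h := Real.log_le_log hpos hdet
    rw [Real.log_mul hC0.ne' hpos2.ne', Real.log_pow, Real.log_pow, Fintype.card_fin] at h
    have := mul_le_mul_of_nonneg_right (Nat.cast_le (α := ℝ).2 hcard) hlog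
    push_cast at h
    linarith
  · simpa only [chiHat, hM, hdef', hdef, hb, dif_neg, not_false_eq_true, zero_add] using
      EReal.coe_nonneg.2 hrem

end Gram

theorem tendsto_factorial_div_pow_mul_finrank {ρ : ℕ → ℕ} {K d r : ℕ}
    (hρ : ∀ n, (n + 1) * ρ n ≤ K * (n + 1) ^ d) (hrd : d ≤ r) (c : ℝ) :
    Filter.Tendsto (fun n : ℕ => (r.factorial : ℝ) / (n : ℝ) ^ r * (ρ n * c)) Filter.atTop
      (nhds 0) := by
  have hbound : ∀ n : ℕ, 1 ≤ n →
      (ρ n : ℝ) / (n : ℝ) ^ r ≤ (K * 2 ^ r : ℝ) * (1 / ((n : ℝ) + 1)) := by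
    intro n hn
    have hn' : (1 : ℝ) ≤ n := by exact_mod_cast hn
    have h1 : ((n : ℝ) + 1) * ρ n ≤ K * (n + 1) ^ d := by exact_mod_cast hρ n
    have h2 : ((n : ℝ) + 1) ^ d ≤ 2 ^ r * (n : ℝ) ^ r := by
      rw [← mul_pow]
      exact (pow_le_pow_right₀ (by linarith) hrd).trans
        (pow_le_pow_left₀ (by linarith) (by linarith) r)
    rw [mul_one_div, div_le_div_iff₀ (by positivity) (by positivity)]
    nlinarith [mul_le_mul_of_nonneg_left h2 (Nat.cast_nonneg (α := ℝ) K)]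
  have hlim : Filter.Tendsto (fun n : ℕ => (ρ n : ℝ) / (n : ℝ) ^ r) Filter.atTop (nhds 0) := by
    refine squeeze_zero' (.of_forall fun n => by positivity)
      (Filter.eventually_atTop.2 ⟨1, hbound⟩) ?_
    simpa using tendsto_one_div_add_atTop_nhds_zero_nat.const_mul (K * 2 ^ r : ℝ)
  have := hlim.const_mul ((r.factorial : ℝ) * c)
  rw [mul_zero] at this
  refine this.congr fun n => ?_
  ring

/-- If one family of seminorms is dominated by another one, uniformly in the degree, and the ranks
grow slowly enough, then the upper asymptotic arithmetic degrees compare. -/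
theorem limsup_chiHat_le_of_dominated {M : ℕ → Type*} [∀ n, AddCommGroup (M n)]
    [∀ n, Module.Finite ℤ (M n)] {K d r : ℕ}
    (hK : ∀ n, (n + 1) * Module.finrank ℤ (M n) ≤ K * (n + 1) ^ d) (hrd : d ≤ r)
    {nrm nrm' : (n : ℕ) → (ℝ ⊗[ℤ] M n) → ℝ} (hH : ∀ n, IsHilbertianSeminorm (M n) (nrm n))
    (hH' : ∀ n, IsHilbertianSeminorm (M n) (nrm' n)) {C : ℝ}
    (hle : ∀ n x, nrm' n x ≤ C * nrm n x) :
    Filter.limsup (fun n : ℕ =>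
        (((r.factorial : ℝ) / (n : ℝ) ^ r : ℝ) : EReal) * chiHat (M n) (nrm n)) Filter.atTop ≤
      Filter.limsup (fun n : ℕ =>
        (((r.factorial : ℝ) / (n : ℝ) ^ r : ℝ) : EReal) * chiHat (M n) (nrm' n)) Filter.atTop := by
  have hle' : ∀ n x, nrm' n x ≤ max 1 C * nrm n x := fun n x => by
    obtain ⟨B, -, -, hB⟩ := hH n
    exact (hle n x).trans
      (mul_le_mul_of_nonneg_right (le_max_right _ _) (hB x ▸ Real.sqrt_nonneg _))
  set ε : ℕ → ℝ := fun n =>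
    (r.factorial : ℝ) / (n : ℝ) ^ r * (Module.finrank ℤ (M n) * Real.log (max 1 C))
  have hε : Filter.limsup (fun n => (ε n : EReal)) Filter.atTop = 0 :=
    ((EReal.tendsto_coe.2 (tendsto_factorial_div_pow_mul_finrank hK hrd _)).limsup_eq)
  calc _ ≤ Filter.limsup ((fun n : ℕ =>
        (((r.factorial : ℝ) / (n : ℝ) ^ r : ℝ) : EReal) * chiHat (M n) (nrm' n)) +
          fun n => (ε n : EReal)) Filter.atTop := by
        refine Filter.limsup_le_limsup (.of_forall fun n => ?_)
        have h0 : (0 : EReal) ≤ (((r.factorial : ℝ) / (n : ℝ) ^ r : ℝ) : EReal) :=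
          EReal.coe_nonneg.2 (by positivity)
        refine (mul_le_mul_of_nonneg_left
          (chiHat_le_chiHat_add (hH n) (hH' n) (le_max_left _ _) (hle' n)) h0).trans_eq ?_
        rw [EReal.left_distrib_of_nonneg_of_ne_top h0 (EReal.coe_ne_top _), ← EReal.coe_mul]
        rfl
    _ ≤ _ := EReal.limsup_add_le (by simp [hε]) (by simp [hε])
    _ = _ := by rw [hε, add_zero]

/-- **Independence of the upper arithmetic Hilbert invariant from the defining family of
seminorms.** Let `A_•` be a commutative `ℕ`-graded ring, generated as a `ℤ`-algebra by finitely
many elements of degree `1`, of Krull dimension `d`, and let `M_• = ⊕ₙ Mₙ` be a finitely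
generated graded `A_•`-module (each `Mₙ` a finitely generated `ℤ`-module). Let `r ≥ d`. If
`(‖·‖_{i,n})ᵢ` and `(‖·‖′_{j,n})ⱼ` are two decreasing families of Hilbertian seminorms on the
`Mₙ ⊗ ℝ` which mutually dominate each other, then
`lim_i limsup_n (r!/nʳ)·χ̂(Mₙ, ‖·‖_{i,n}) = lim_j limsup_n (r!/nʳ)·χ̂(Mₙ, ‖·‖′_{j,n})`,
the limits over `i` (resp. `j`) being suprema of nondecreasing sequences in the extended
reals. -/
theorem upper_arithmetic_hilbert_invariant_independent
    (A : Type*) [CommRing A] (𝒜 : ℕ → AddSubgroup A) [GradedRing 𝒜]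
    (hgen : ∃ s : Finset A, (↑s : Set A) ⊆ (𝒜 1 : Set A) ∧ Algebra.adjoin ℤ (↑s : Set A) = ⊤)
    (d : ℕ) (hdim : ringKrullDim A = d)
    (M : Type*) [AddCommGroup M] [Module A M] [Module.Finite A M]
    (ℳ : ℕ → Submodule ℤ M) [DirectSum.Decomposition ℳ] [SetLike.GradedSMul 𝒜 ℳ]
    (hfin : ∀ n, Module.Finite ℤ ↥(ℳ n))
    (r : ℕ) (hrd : d ≤ r)
    (nrm nrm' : (i : ℕ) → (n : ℕ) → (ℝ ⊗[ℤ] ↥(ℳ n)) → ℝ)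
    (hH : ∀ i n, IsHilbertianSeminorm ↥(ℳ n) (nrm i n))
    (hH' : ∀ j n, IsHilbertianSeminorm ↥(ℳ n) (nrm' j n))
    (hdec : ∀ i n x, nrm (i + 1) n x ≤ nrm i n x)
    (hdec' : ∀ j n x, nrm' (j + 1) n x ≤ nrm' j n x)
    (hdom : ∀ i, ∃ j, ∃ C > (0 : ℝ), ∀ n x, nrm' j n x ≤ C * nrm i n x)
    (hdom' : ∀ j, ∃ i, ∃ C > (0 : ℝ), ∀ n x, nrm i n x ≤ C * nrm' j n x) :
    (⨆ i : ℕ, Filter.limsup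
        (fun n : ℕ =>
          (((r.factorial : ℝ) / (n : ℝ) ^ r : ℝ) : EReal) * chiHat ↥(ℳ n) (nrm i n))
        Filter.atTop)
      = ⨆ j : ℕ, Filter.limsup
        (fun n : ℕ =>
          (((r.factorial : ℝ) / (n : ℝ) ^ r : ℝ) : EReal) * chiHat ↥(ℳ n) (nrm' j n))
        Filter.atTop := by
  obtain ⟨K, hK⟩ := exists_finrank_graded_le 𝒜 hgen hdim ℳ
  refine le_antisymm (iSup_le fun i => ?_) (iSup_le fun j => ?_)
  · obtain ⟨j, C, -, hC⟩ := hdom i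
    exact le_iSup_of_le j (limsup_chiHat_le_of_dominated hK hrd (hH i) (hH' j) hC)
  · obtain ⟨i, C, -, hC⟩ := hdom' j
    exact le_iSup_of_le i (limsup_chiHat_le_of_dominated hK hrd (hH' j) (hH i) hC)
end
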